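/- Let p be a prime, let iota be an index set with a distinguished element i0, let H be a finite group, and for each i in iota let G_i be a finite group with an injective homomorphism phi_i: H -> G_i. Suppose that for every i different from i0, phi_i maps some (equivalently, every) Sylow p-subgroup of H onto a Sylow p-subgroup of G_i. Let Pi be the amalgamated free product of the groups G_i over the common subgroup H (the pushout of the diagram of the maps phi_i), and let S be a Sylow p-subgroup of G_{i0}. Then the image of S under the canonical homomorphism G_{i0} -> Pi is a Sylow p-subgroup of Pi, in the sense that every finite p-subgroup of Pi is conjugate in Pi to a subgroup of the image of S. -/

import Mathlib

namespace Monoid.PushoutI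

variable {ι : Type*} {G : ι → Type*} {H : Type*} [∀ i, Group (G i)] [Group H]
  {φ : ∀ i, H →* G i}

variable (φ) in
/-- The product in the pushout of a list of elements of the factors. -/
def listProd (L : List (Σ i, G i)) : PushoutI φ :=
  (L.map fun l => of l.1 l.2).prod

variable (φ) in
/-- A list of elements of the factors is reduced if consecutive letters lie in different factors
and no letter lies in the base group. -/
def IsReducedList (L : List (Σ i, G i)) : Prop :=
  L.IsChain (fun a b => a.1 ≠ b.1) ∧ ∀ l ∈ L, l.2 ∉ (φ l.1).range

/-- The list of inverses, in reverse order. -/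
def invList (L : List (Σ i, G i)) : List (Σ i, G i) :=
  (L.map fun l => ⟨l.1, l.2⁻¹⟩).reverse

@[simp]
theorem length_invList (L : List (Σ i, G i)) : (invList L).length = L.length := by
  simp [invList]

@[simp]
theorem listProd_nil : listProd φ [] = 1 := rfl

@[simp]
theorem listProd_cons (a : Σ i, G i) (L : List (Σ i, G i)) :
    listProd φ (a :: L) = of a.1 a.2 * listProd φ L := by
  simp [listProd]

@[simp]
theorem listProd_append (L M : List (Σ i, G i)) :
    listProd φ (L ++ M) = listProd φ L * listProd φ M := by
  simp [listProd]

@[simp]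
theorem listProd_invList (L : List (Σ i, G i)) :
    listProd φ (invList L) = (listProd φ L)⁻¹ := by
  induction L with
  | nil => simp [invList]
  | cons a L ih =>
    have : invList (a :: L) = invList L ++ [⟨a.1, a.2⁻¹⟩] := by simp [invList]
    simp [this, ih]

theorem IsReducedList.invList {L : List (Σ i, G i)} (hL : IsReducedList φ L) :
    IsReducedList φ (invList L) := by
  refine ⟨?_, ?_⟩
  · rw [PushoutI.invList, List.isChain_reverse, List.isChain_map]
    exact hL.1.imp fun _ _ h => h.symm
  · intro l hl
    simp only [PushoutI.invList, List.mem_reverse, List.mem_map] at hl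
    obtain ⟨m, hm, rfl⟩ := hl
    simpa using hL.2 m hm

theorem isReducedList_singleton {i : ι} {g : G i} (hg : g ∉ (φ i).range) :
    IsReducedList φ [⟨i, g⟩] :=
  ⟨by simp, by simpa using hg⟩

/-- Reducedness of a list only depends on the indices and on letters avoiding the base group. -/
theorem IsReducedList.replace {L M : List (Σ i, G i)} {i : ι} {g g' : G i}
    (h : IsReducedList φ (L ++ ⟨i, g⟩ :: M)) (hg' : g' ∉ (φ i).range) :
    IsReducedList φ (L ++ ⟨i, g'⟩ :: M) := by
  obtain ⟨h₁, h₂⟩ := h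
  refine ⟨?_, ?_⟩
  · rw [← List.isChain_map Sigma.fst (R := (· ≠ ·))] at h₁ ⊢
    simpa using h₁
  · intro l hl
    simp only [List.mem_append, List.mem_cons] at hl h₂
    rcases hl with hl | rfl | hl
    · exact h₂ l (.inl hl)
    · exact hg'
    · exact h₂ l (.inr (.inr hl))

theorem IsReducedList.append_cons {L M : List (Σ i, G i)} {a : Σ i, G i}
    (h₁ : IsReducedList φ (L ++ [a])) (h₂ : IsReducedList φ (a :: M)) :
    IsReducedList φ (L ++ a :: M) := by
  refine ⟨List.isChain_split.2 ⟨h₁.1, h₂.1⟩, ?_⟩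
  intro l hl
  rw [List.mem_append] at hl
  rcases hl with hl | hl
  · exact h₁.2 l (by simp [hl])
  · exact h₂.2 l hl

theorem exists_eq_base_mul_listProd (hφ : ∀ i, Function.Injective (φ i)) (g : PushoutI φ) :
    ∃ (h : H) (L : List (Σ i, G i)), IsReducedList φ L ∧ g = base φ h * listProd φ L := by
  classical
  obtain ⟨d⟩ := NormalWord.transversal_nonempty φ hφ
  obtain ⟨w, rfl⟩ := (NormalWord.equiv (d := d)).symm.surjective g
  refine ⟨w.head, w.toList, ⟨w.chain_ne, ?_⟩, ?_⟩
  · rintro ⟨i, g⟩ hl hg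
    have h1 := (d.compl i).coe_equiv_snd_eq_one_iff_mem (d.one_mem i) |>.2 hg
    rw [((d.compl i).equiv_snd_eq_self_iff_mem (one_mem _)).2 (w.normalized i g hl)] at h1
    exact w.ne_one _ hl h1
  · change NormalWord.prod w = _
    simp [NormalWord.prod, CoprodI.Word.prod, listProd, map_list_prod, Function.comp_def]

variable (φ) in
/-- A word length on an amalgamated product: it is computed by reduced lists, and it is
invariant under multiplication by the base group. -/
structure IsLength (ℓ : PushoutI φ → ℕ) : Prop where
  /-- The length of a reduced product is its number of letters. -/
  listProd : ∀ L, IsReducedList φ L → ℓ (listProd φ L) = L.length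
  /-- Left multiplication by the base group preserves the length. -/
  base_mul : ∀ h g, ℓ (base φ h * g) = ℓ g

theorem exists_isLength (hφ : ∀ i, Function.Injective (φ i)) :
    ∃ ℓ : PushoutI φ → ℕ, IsLength φ ℓ := by
  classical
  obtain ⟨d⟩ := NormalWord.transversal_nonempty φ hφ
  refine ⟨fun g => (NormalWord.equiv (d := d) g).toList.length, ?_, ?_⟩
  · intro L hL
    let w : CoprodI.Word G :=
      ⟨L, fun l hl h1 => hL.2 l hl (h1 ▸ one_mem _), hL.1⟩
    have hw : Reduced φ w := hL.2
    obtain ⟨w', hw', hmap⟩ := hw.exists_normalWord_prod_eq d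
    have hprod : listProd φ L = w'.prod := by
      rw [hw']
      simp [w, CoprodI.Word.prod, listProd, map_list_prod, Function.comp_def]
    have hequiv : NormalWord.equiv (d := d) (listProd φ L) = w' := by
      rw [hprod]
      exact NormalWord.equiv.apply_symm_apply w'
    simpa [hequiv, w] using congrArg List.length hmap
  · intro h g
    change ((base φ h * g) • (NormalWord.empty (d := d))).toList.length =
      (g • (NormalWord.empty (d := d))).toList.length
    rw [mul_smul, NormalWord.base_smul_def]

theorem IsReducedList.tail {a : Σ i, G i} {L : List (Σ i, G i)}
    (h : IsReducedList φ (a :: L)) : IsReducedList φ L :=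
  ⟨h.1.tail, fun l hl => h.2 l (List.mem_cons_of_mem _ hl)⟩

theorem mem_range_base_or_exists_listProd (hφ : ∀ i, Function.Injective (φ i))
    (g : PushoutI φ) :
    g ∈ (base φ).range ∨ ∃ a L, IsReducedList φ (a :: L) ∧ g = listProd φ (a :: L) := by
  obtain ⟨h, _ | ⟨⟨i, a⟩, L⟩, hL, rfl⟩ := exists_eq_base_mul_listProd hφ g
  · left
    simp
  · right
    refine ⟨⟨i, φ i h * a⟩, L, IsReducedList.replace (L := []) hL ?_, ?_⟩
    · rw [Subgroup.mul_mem_cancel_left _ (MonoidHom.mem_range.2 ⟨h, rfl⟩)]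
      exact hL.2 ⟨i, a⟩ (by simp)
    · simp [of_apply_eq_base, mul_assoc]

namespace IsLength

variable {ℓ : PushoutI φ → ℕ}

theorem base (hℓ : IsLength φ ℓ) (h : H) : ℓ (base φ h) = 0 := by
  have h₁ := hℓ.base_mul h 1
  have h₂ := hℓ.listProd [] ⟨by simp, by simp⟩
  rw [mul_one] at h₁
  exact h₁.trans h₂

theorem inv (hℓ : IsLength φ ℓ) (hφ : ∀ i, Function.Injective (φ i)) (g : PushoutI φ) :
    ℓ g⁻¹ = ℓ g := by
  obtain ⟨h, rfl⟩ | ⟨a, L, hL, rfl⟩ := mem_range_base_or_exists_listProd hφ g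
  · rw [← map_inv, hℓ.base, hℓ.base]
  · rw [← listProd_invList, hℓ.listProd _ hL, hℓ.listProd _ hL.invList, length_invList]

theorem mul_base (hℓ : IsLength φ ℓ) (hφ : ∀ i, Function.Injective (φ i)) (g : PushoutI φ)
    (h : H) : ℓ (g * PushoutI.base φ h) = ℓ g := by
  rw [← hℓ.inv hφ, mul_inv_rev, ← map_inv, hℓ.base_mul, hℓ.inv hφ]

theorem of_le_one (hℓ : IsLength φ ℓ) (i : ι) (g : G i) : ℓ (of i g) ≤ 1 := by
  by_cases hg : g ∈ (φ i).range
  · obtain ⟨h, rfl⟩ := hg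
    rw [of_apply_eq_base, hℓ.base]
    exact zero_le_one
  · simpa using (hℓ.listProd _ (isReducedList_singleton hg)).le

/-- If the quotient of two reduced products is no longer than the first one, then the two
products start in the same factor, and with the same coset of the base group there unless the
second one is a single letter. -/
theorem head_eq_of_length_le (hℓ : IsLength φ ℓ) {a b : Σ i, G i} {A B : List (Σ i, G i)}
    (ha : IsReducedList φ (a :: A)) (hb : IsReducedList φ (b :: B))
    (hle : ℓ ((PushoutI.listProd φ (a :: A))⁻¹ * PushoutI.listProd φ (b :: B)) ≤
      (a :: A).length) :
    ∃ c, b = ⟨a.1, c⟩ ∧ (B = [] ∨ ∃ k, c = a.2 * φ a.1 k) := by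
  obtain ⟨i, a⟩ := a
  obtain ⟨j, b⟩ := b
  have hinv : PushoutI.invList (⟨i, a⟩ :: A) = PushoutI.invList A ++ [⟨i, a⁻¹⟩] := by
    simp [PushoutI.invList]
  have ha' := ha.invList
  rw [hinv] at ha'
  by_cases hij : j = i
  · subst hij
    refine ⟨b, rfl, ?_⟩
    by_cases hab : a⁻¹ * b ∈ (φ j).range
    · obtain ⟨k, hk⟩ := hab
      exact .inr ⟨k, by simp [hk]⟩
    · left
      have hr := (ha'.replace hab).append_cons (IsReducedList.replace (L := []) hb hab)
      have hlen := hℓ.listProd _ hr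
      simp only [listProd_append, listProd_cons, listProd_invList, map_mul, map_inv, mul_inv_rev,
        mul_assoc, List.length_append, length_invList, List.length_cons] at hlen hle
      rw [← List.length_eq_zero_iff]
      lia
  · have hr : IsReducedList φ (PushoutI.invList A ++ ⟨i, a⁻¹⟩ :: ⟨j, b⟩ :: B) := by
      refine ha'.append_cons ⟨List.isChain_cons_cons.2 ⟨fun h => hij h.symm, hb.1⟩, ?_⟩
      intro l hl
      rw [List.mem_cons] at hl
      rcases hl with rfl | hl
      · exact ha'.2 _ (by simp)
      · exact hb.2 l hl
    have hlen := hℓ.listProd _ hr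
    simp only [listProd_append, listProd_cons, listProd_invList, map_inv, mul_inv_rev,
      mul_assoc, List.length_append, length_invList, List.length_cons] at hlen hle
    lia

/-- If `x` is a reduced product with first letter `a` and at least two letters, and if `y`, `x⁻¹ y`
and `x⁻¹ y⁻¹` are no longer than `x`, then `a⁻¹ y a` is shorter than `x`. -/
theorem conj_le (hℓ : IsLength φ ℓ) (hφ : ∀ i, Function.Injective (φ i))
    {a : Σ i, G i} {A : List (Σ i, G i)} (ha : IsReducedList φ (a :: A)) (hA : A ≠ [])
    {y : PushoutI φ} (hy : ℓ y ≤ (a :: A).length)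
    (h₁ : ℓ ((PushoutI.listProd φ (a :: A))⁻¹ * y) ≤ (a :: A).length)
    (h₂ : ℓ ((PushoutI.listProd φ (a :: A))⁻¹ * y⁻¹) ≤ (a :: A).length) :
    ℓ ((of a.1 a.2)⁻¹ * y * of a.1 a.2) ≤ A.length := by
  have hA1 : 1 ≤ A.length := List.length_pos_iff.2 hA
  obtain ⟨h, rfl⟩ | ⟨b, B, hb, rfl⟩ := mem_range_base_or_exists_listProd hφ y
  · rw [← of_apply_eq_base φ a.1, ← map_inv, ← map_mul, ← map_mul]
    exact (hℓ.of_le_one _ _).trans hA1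
  obtain ⟨b, rfl, hB | ⟨k, rfl⟩⟩ := hℓ.head_eq_of_length_le ha hb h₁
  · subst hB
    rw [listProd_cons, listProd_nil, mul_one, ← map_inv, ← map_mul, ← map_mul]
    exact (hℓ.of_le_one _ _).trans hA1
  obtain rfl | ⟨M, c, rfl⟩ := List.eq_nil_or_concat' B
  · rw [listProd_cons, listProd_nil, mul_one, ← map_inv, ← map_mul, ← map_mul]
    exact (hℓ.of_le_one _ _).trans hA1
  have hb' := hb.invList
  have hinv : PushoutI.invList (⟨a.1, a.2 * φ a.1 k⟩ :: (M ++ [c])) =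
    ⟨c.1, c.2⁻¹⟩ :: PushoutI.invList (⟨a.1, a.2 * φ a.1 k⟩ :: M) := by
    simp [PushoutI.invList]
  rw [← listProd_invList (_ :: (M ++ [c])), hinv] at h₂
  rw [hinv] at hb'
  obtain ⟨c', hc, hnil | ⟨k', rfl⟩⟩ := hℓ.head_eq_of_length_le ha hb' h₂
  · simpa using congrArg List.length hnil
  have hM : IsReducedList φ M :=
    ⟨hb.tail.1.left_of_append, fun l hl => hb.tail.2 l (by simp [hl])⟩
  have hc' : of (φ := φ) c.1 c.2 * of a.1 a.2 = PushoutI.base φ k'⁻¹ := by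
    have := congrArg (fun l : Σ i, G i => (of (φ := φ) l.1 l.2)⁻¹) hc
    simp only [map_inv, inv_inv, map_mul, mul_inv_rev, of_apply_eq_base] at this
    rw [this, map_inv]
    simp
  have hz : (of a.1 a.2)⁻¹ * PushoutI.listProd φ (⟨a.1, a.2 * φ a.1 k⟩ :: (M ++ [c])) *
      of a.1 a.2 = PushoutI.base φ k * (PushoutI.listProd φ M * PushoutI.base φ k'⁻¹) := by
    rw [← hc']
    simp [of_apply_eq_base, mul_assoc]
  rw [hz, hℓ.base_mul, hℓ.mul_base hφ, hℓ.listProd M hM]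
  simp only [List.length_cons, List.length_append, hℓ.listProd _ hb] at hy
  lia

theorem exists_le_range_of (hℓ : IsLength φ ℓ) (hφ : ∀ i, Function.Injective (φ i))
    [Nonempty ι] {P : Subgroup (PushoutI φ)} (hP : ∀ x ∈ P, ℓ x ≤ 1) :
    ∃ i, P ≤ (of (φ := φ) i).range := by
  have hbase (i : ι) : (PushoutI.base φ).range ≤ (of (φ := φ) i).range := by
    rintro _ ⟨h, rfl⟩
    exact ⟨φ i h, of_apply_eq_base φ i h⟩
  have hsingle : ∀ x ∈ P, x ∈ (PushoutI.base φ).range ∨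
      ∃ a, IsReducedList φ [a] ∧ x = of a.1 a.2 := by
    intro x hx
    obtain h | ⟨a, A, hA, rfl⟩ := mem_range_base_or_exists_listProd hφ x
    · exact .inl h
    · have := hP _ hx
      rw [hℓ.listProd _ hA] at this
      obtain rfl : A = [] := by simpa using this
      exact .inr ⟨a, hA, by simp⟩
  by_cases hPb : P ≤ (PushoutI.base φ).range
  · exact ⟨Classical.arbitrary ι, hPb.trans (hbase _)⟩
  obtain ⟨x, hx, hxb⟩ := SetLike.not_le_iff_exists.1 hPb
  obtain ⟨a, ha, rfl⟩ := (hsingle x hx).resolve_left hxb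
  refine ⟨a.1, fun y hy => ?_⟩
  obtain h | ⟨b, hb, rfl⟩ := hsingle y hy
  · exact hbase _ h
  obtain ⟨c, rfl, -⟩ := hℓ.head_eq_of_length_le ha hb (by
    simpa using hP _ (P.mul_mem (P.inv_mem hx) hy))
  exact ⟨c, rfl⟩

theorem exists_conj_le_range_of (hℓ : IsLength φ ℓ) (hφ : ∀ i, Function.Injective (φ i))
    [Nonempty ι] (n : ℕ) {P : Subgroup (PushoutI φ)} (hP : ∀ x ∈ P, ℓ x ≤ n) :
    ∃ g i, P.map (MulAut.conj g).toMonoidHom ≤ (of (φ := φ) i).range := by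
  induction n generalizing P with
  | zero =>
    obtain ⟨i, hi⟩ := hℓ.exists_le_range_of hφ fun x hx => (hP x hx).trans zero_le_one
    exact ⟨1, i, by rintro _ ⟨x, hx, rfl⟩; simpa using hi hx⟩
  | succ n ih =>
    by_cases hn : ∀ x ∈ P, ℓ x ≤ n
    · exact ih hn
    push Not at hn
    obtain ⟨x, hx, hxn⟩ := hn
    replace hxn : ℓ x = n + 1 := le_antisymm (hP x hx) hxn
    obtain ⟨h, rfl⟩ | ⟨a, A, ha, rfl⟩ := mem_range_base_or_exists_listProd hφ x
    · simp [hℓ.base] at hxn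
    rw [hℓ.listProd _ ha] at hxn
    obtain rfl : A.length = n := by simpa using hxn
    by_cases hA : A = []
    · subst hA
      obtain ⟨i, hi⟩ := hℓ.exists_le_range_of hφ hP
      exact ⟨1, i, by rintro _ ⟨x, hx, rfl⟩; simpa using hi hx⟩
    obtain ⟨g, i, hg⟩ := ih (P := P.map (MulAut.conj (of a.1 a.2)⁻¹).toMonoidHom) <| by
      rintro _ ⟨y, hy, rfl⟩
      simpa using hℓ.conj_le hφ ha hA (hP y hy)
        (hP _ (P.mul_mem (P.inv_mem hx) hy))
        (hP _ (P.mul_mem (P.inv_mem hx) (P.inv_mem hy)))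
    refine ⟨g * (of a.1 a.2)⁻¹, i, ?_⟩
    rintro _ ⟨y, hy, rfl⟩
    have := hg ⟨_, ⟨y, hy, rfl⟩, rfl⟩
    simpa [mul_assoc] using this

end IsLength

/-- A finite subgroup of an amalgamated product is conjugate to a subgroup of one of the
factors. -/
theorem exists_conj_le_range_of_finite (hφ : ∀ i, Function.Injective (φ i)) [Nonempty ι]
    (P : Subgroup (PushoutI φ)) [Finite P] :
    ∃ g i, P.map (MulAut.conj g).toMonoidHom ≤ (of (φ := φ) i).range := by
  obtain ⟨ℓ, hℓ⟩ := exists_isLength hφ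
  obtain ⟨n, hn⟩ := (Set.finite_range fun x : P => ℓ x).bddAbove
  exact hℓ.exists_conj_le_range_of hφ n fun x hx => hn ⟨⟨x, hx⟩, rfl⟩

end Monoid.PushoutI

/-- In a finite group, every `p`-subgroup is conjugate to a subgroup of a given Sylow
`p`-subgroup. -/
theorem IsPGroup.exists_conj_mem_sylow {p : ℕ} [Fact p.Prime] {G : Type*} [Group G] [Finite G]
    {P : Subgroup G} (hP : IsPGroup p P) (S : Sylow p G) :
    ∃ g : G, ∀ x ∈ P, g * x * g⁻¹ ∈ (S : Subgroup G) := by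
  obtain ⟨Q, hQ⟩ := hP.exists_le_sylow
  obtain ⟨g, rfl⟩ := MulAction.exists_smul_eq G Q S
  refine ⟨g, fun x hx => ?_⟩
  rw [Sylow.coe_subgroup_smul]
  exact Subgroup.smul_mem_pointwise_smul x (MulAut.conj g) _ (hQ hx)


/-- Let `p` be a prime, `H` a finite group and `(G i)` a family of finite groups with
injective homomorphisms `φ i : H →* G i`, indexed by `ι` with a distinguished element
`i₀`.  Suppose that for every `i ≠ i₀` the map `φ i` carries every Sylow `p`-subgroup of
`H` onto a Sylow `p`-subgroup of `G i`.  Let `Π` be the amalgamated free product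
(pushout) of the `G i` over `H`, and let `S` be a Sylow `p`-subgroup of `G i₀`.  Then
the image of `S` in `Π` is a Sylow `p`-subgroup of `Π`: every finite `p`-subgroup of `Π`
is conjugate in `Π` to a subgroup of the image of `S`. -/
theorem stmt_6 (p : ℕ) (hp : Nat.Prime p)
    (ι : Type*) (i₀ : ι) (H : Type*) [Group H] [Finite H]
    (G : ι → Type*) [∀ i, Group (G i)] [∀ i, Finite (G i)]
    (φ : ∀ i, H →* G i) (hinj : ∀ i, Function.Injective (φ i))
    (hsyl : ∀ i, i ≠ i₀ → ∀ P : Sylow p H,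
      ∃ Q : Sylow p (G i), (Q : Subgroup (G i)) = Subgroup.map (φ i) (P : Subgroup H))
    (S : Sylow p (G i₀))
    (P : Subgroup (Monoid.PushoutI φ)) (hPfin : Finite P) (hP : IsPGroup p P) :
    ∃ g : Monoid.PushoutI φ,
      P.map (MulAut.conj g).toMonoidHom ≤
        Subgroup.map (Monoid.PushoutI.of (φ := φ) i₀) (S : Subgroup (G i₀)) := by
  have := Fact.mk hp
  have : Nonempty ι := ⟨i₀⟩
  -- It suffices to conjugate `P` into the factor `G i₀`.
  suffices h : ∃ g : Monoid.PushoutI φ,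
      ∀ x ∈ P, g * x * g⁻¹ ∈ (Monoid.PushoutI.of (φ := φ) i₀).range by
    obtain ⟨g, hg⟩ := h
    have hK : IsPGroup p ((P.map (MulAut.conj g).toMonoidHom).comap
        (Monoid.PushoutI.of (φ := φ) i₀)) :=
      (hP.map _).comap_of_injective _ (Monoid.PushoutI.of_injective hinj i₀)
    obtain ⟨s, hs⟩ := hK.exists_conj_mem_sylow S
    refine ⟨Monoid.PushoutI.of i₀ s * g, ?_⟩
    rintro _ ⟨x, hx, rfl⟩
    obtain ⟨y, hy⟩ := hg x hx
    refine ⟨_, hs y ⟨x, hx, by simp [hy]⟩, ?_⟩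
    simp [hy, mul_assoc]
  obtain ⟨g, i, hg⟩ := Monoid.PushoutI.exists_conj_le_range_of_finite hinj P
  obtain rfl | hi := eq_or_ne i i₀
  · exact ⟨g, fun x hx => hg ⟨x, hx, rfl⟩⟩
  obtain ⟨Q, hQ⟩ := hsyl i hi default
  have hK : IsPGroup p ((P.map (MulAut.conj g).toMonoidHom).comap
      (Monoid.PushoutI.of (φ := φ) i)) :=
    (hP.map _).comap_of_injective _ (Monoid.PushoutI.of_injective hinj i)
  obtain ⟨s, hs⟩ := hK.exists_conj_mem_sylow Q
  refine ⟨Monoid.PushoutI.of i s * g, fun x hx => ?_⟩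
  obtain ⟨y, hy⟩ := hg ⟨x, hx, rfl⟩
  have hyQ := hs y ⟨x, hx, hy.symm⟩
  rw [hQ] at hyQ
  obtain ⟨h, -, hh⟩ := hyQ
  have hy' : Monoid.PushoutI.of (φ := φ) i y = g * x * g⁻¹ := by simpa using hy
  refine ⟨φ i₀ h, ?_⟩
  rw [Monoid.PushoutI.of_apply_eq_base, ← Monoid.PushoutI.of_apply_eq_base φ i, hh]
  simp [hy', mul_assoc]
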